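/- arXiv:2210.10101 — 5 statements merged into one kernel-verified Lean document; each statement's English description precedes it below -/
import Mathlib

section
/- Let k be a kernel on a set 𝒳 and let x₁,…,x_m ∈ 𝒳 be distinct training inputs with labels Y ∈ ℝᵐ, and suppose the Gram matrix K_XX (with (K_XX)ᵢⱼ = k(xᵢ,xⱼ)) is positive definite. Define f⋆(x) = Σᵢ (K_XX⁻¹Y)ᵢ · k(x,xᵢ). Then: (1) f⋆ interpolates the data, i.e. f⋆(xⱼ) = Yⱼ for all j = 1,…,m; and (2) f⋆ has minimum RKHS norm among all pre-RKHS interpolators: for every pre-RKHS function g determined by centres x′₁,…,x′ₙ ∈ 𝒳 and coefficients β ∈ ℝⁿ satisfying g(xⱼ) = Yⱼ for all j, one has βᵀK_{X′X′}β ≥ YᵀK_XX⁻¹Y, where K_{X′X′} is the Gram matrix of the centres of g. -/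
open Matrix

/-- Minimum-RKHS-norm kernel interpolation: with a positive definite Gram
matrix `K` on distinct training inputs, the function `f⋆ z = ∑ i, (K⁻¹Y)ᵢ k z (x i)`
interpolates the data, and any pre-RKHS interpolator `g` (with centres `c` and
coefficients `β`) has squared RKHS norm `βᵀK'β` at least `YᵀK⁻¹Y`. -/
theorem min_rkhs_norm_kernel_interpolation {X : Type*} (k : X → X → ℝ)
    (hsymm : ∀ a b, k a b = k b a)
    (hpsd : ∀ (n : ℕ) (z : Fin n → X),
      (Matrix.of fun i j => k (z i) (z j)).PosSemidef)
    (m : ℕ) (x : Fin m → X) (hx : Function.Injective x) (Y : Fin m → ℝ)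
    (K : Matrix (Fin m) (Fin m) ℝ) (hK : K = Matrix.of fun i j => k (x i) (x j))
    (hKpd : K.PosDef)
    (fstar : X → ℝ)
    (hfstar : ∀ z, fstar z = ∑ i, (K⁻¹ *ᵥ Y) i * k z (x i)) :
    (∀ j, fstar (x j) = Y j) ∧
    (∀ (n : ℕ) (c : Fin n → X) (β : Fin n → ℝ),
      (∀ j, (∑ i, β i * k (x j) (c i)) = Y j) →
      Y ⬝ᵥ (K⁻¹ *ᵥ Y) ≤ β ⬝ᵥ ((Matrix.of fun i j => k (c i) (c j)) *ᵥ β)) := by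
  have hdet : IsUnit K.det := (Matrix.isUnit_iff_isUnit_det K).mp hKpd.isUnit
  have hKa : K *ᵥ (K⁻¹ *ᵥ Y) = Y := by
    rw [Matrix.mulVec_mulVec, Matrix.mul_nonsing_inv K hdet, Matrix.one_mulVec]
  generalize K⁻¹ *ᵥ Y = a at *
  have h1 : ∀ j, ∑ i, a i * k (x j) (x i) = Y j := by
    intro j
    have := congrFun hKa j
    rw [← this, hK]
    simp only [Matrix.mulVec, dotProduct, Matrix.of_apply]
    exact Finset.sum_congr rfl fun i _ => mul_comm _ _
  refine ⟨fun j => by rw [hfstar, h1], ?_⟩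
  intro n c β hβ
  have h := (hpsd (m + n) (Fin.append x c)).dotProduct_mulVec_nonneg (Fin.append a (-β))
  have e1 : ∀ j, ∑ i, k (x j) (x i) * a i = Y j := by
    intro j
    rw [← h1 j]
    exact Finset.sum_congr rfl fun i _ => mul_comm _ _
  have e2 : ∀ j, ∑ i, k (x j) (c i) * β i = Y j := by
    intro j
    rw [← hβ j]
    exact Finset.sum_congr rfl fun i _ => mul_comm _ _
  have e3 : ∑ i, β i * ∑ j, k (c i) (x j) * a j = ∑ j, a j * Y j := by
    simp_rw [← e2, Finset.mul_sum]
    rw [Finset.sum_comm]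
    refine Finset.sum_congr rfl fun i _ => Finset.sum_congr rfl fun j _ => ?_
    rw [hsymm (c j) (x i)]
    ring
  have e4 : ∑ j, Y j * a j = ∑ j, a j * Y j :=
    Finset.sum_congr rfl fun i _ => mul_comm _ _
  simp only [Matrix.mulVec, dotProduct, Matrix.of_apply, Fin.sum_univ_add, Fin.append_left,
    Fin.append_right, star_trivial, Pi.neg_apply, mul_neg, neg_mul, Finset.sum_neg_distrib,
    mul_add, Finset.sum_add_distrib, e1, e2, e3] at h ⊢
  rw [e4]
  linarith
end

section
/- Let k be a kernel on a set 𝒳 and let g be a pre-RKHS function determined by centres x′₁,…,x′ₙ ∈ 𝒳 and coefficients β ∈ ℝⁿ. Let x₁,…,x_m ∈ 𝒳 be distinct inputs with positive definite Gram matrix K_XX, let g_X = (g(x₁),…,g(x_m)) ∈ ℝᵐ, and let f⋆(x) = K_xX K_XX⁻¹ g_X be the minimum RKHS norm interpolator of (X, g_X). Then for every x ∈ 𝒳: |g(x) − f⋆(x)| ≤ √(βᵀK_{X′X′}β − g_Xᵀ K_XX⁻¹ g_X) · √(k(x,x) − K_xX K_XX⁻¹ K_Xx), where K_{X′X′} is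 the Gram matrix of the centres of g. -/
open Matrix

/-- The quadratic form of a kernel is nonnegative over any finite index type. -/
lemma kernel_form_nonneg {X ι : Type*} [Fintype ι] (k : X → X → ℝ)
    (hpsd : ∀ (n : ℕ) (z : Fin n → X),
      (Matrix.of fun i j => k (z i) (z j)).PosSemidef)
    (p : ι → X) (a : ι → ℝ) :
    0 ≤ a ⬝ᵥ ((Matrix.of fun i j => k (p i) (p j)) *ᵥ a) := by
  have e := Fintype.equivFin ι
  have h := (hpsd _ (p ∘ e.symm)).submatrix e
  have h2 := h.dotProduct_mulVec_nonneg a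
  have h3 : (Matrix.of fun i j => k ((p ∘ e.symm) i) ((p ∘ e.symm) j)).submatrix e e
      = Matrix.of fun i j => k (p i) (p j) := by
    ext i j; simp
  rw [h3] at h2
  simpa using h2

/-- Error of kernel interpolation: for a pre-RKHS function `g` (centres `c`,
coefficients `β`) and the minimum RKHS norm interpolator `f⋆ z = K_zX K_XX⁻¹ g_X` of the
samples `(x, g_X)`, the deviation `|g z − f⋆ z|` is bounded by
`√(βᵀK'β − g_Xᵀ K_XX⁻¹ g_X) · √(k z z − K_zX K_XX⁻¹ K_Xz)`. -/
theorem kernel_interpolation_error {X : Type*} (k : X → X → ℝ)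
    (hsymm : ∀ a b, k a b = k b a)
    (hpsd : ∀ (n : ℕ) (z : Fin n → X),
      (Matrix.of fun i j => k (z i) (z j)).PosSemidef)
    (n : ℕ) (c : Fin n → X) (β : Fin n → ℝ)
    (g : X → ℝ) (hg : ∀ z, g z = ∑ i, β i * k z (c i))
    (m : ℕ) (x : Fin m → X) (hx : Function.Injective x)
    (K : Matrix (Fin m) (Fin m) ℝ) (hK : K = Matrix.of fun i j => k (x i) (x j))
    (hKpd : K.PosDef)
    (gX : Fin m → ℝ) (hgX : ∀ j, gX j = g (x j))
    (fstar : X → ℝ)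
    (hfstar : ∀ z, fstar z = (fun i => k z (x i)) ⬝ᵥ (K⁻¹ *ᵥ gX))
    (z : X) :
    |g z - fstar z| ≤
      Real.sqrt (β ⬝ᵥ ((Matrix.of fun i j => k (c i) (c j)) *ᵥ β) - gX ⬝ᵥ (K⁻¹ *ᵥ gX)) *
        Real.sqrt (k z z - (fun i => k z (x i)) ⬝ᵥ (K⁻¹ *ᵥ fun i => k (x i) z)) := by
  have hKs : Kᵀ = K := by
    rw [hK]; ext i j; exact hsymm _ _
  have hdet : IsUnit K.det := hKpd.det_pos.ne'.isUnit
  set w : Fin m → ℝ := fun i => k z (x i) with hw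
  have hw2 : (fun i => k (x i) z) = w := by
    ext i; exact hsymm _ _
  rw [hw2, hfstar z]
  change |g z - w ⬝ᵥ (K⁻¹ *ᵥ gX)| ≤ _
  set u := K⁻¹ *ᵥ gX with hu
  set v := K⁻¹ *ᵥ w with hv
  have hKu : K *ᵥ u = gX := by
    rw [hu, mulVec_mulVec, mul_nonsing_inv _ hdet, one_mulVec]
  have hKv : K *ᵥ v = w := by
    rw [hv, mulVec_mulVec, mul_nonsing_inv _ hdet, one_mulVec]
  have hvg : gX ⬝ᵥ v = w ⬝ᵥ u := by
    rw [← hKv, ← hKu, dotProduct_comm, dotProduct_mulVec, ← mulVec_transpose, hKs]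
  have hcross : ∀ a : Fin m → ℝ,
      β ⬝ᵥ ((Matrix.of fun i j => k (c i) (x j)) *ᵥ a) = gX ⬝ᵥ a := by
    intro a
    rw [dotProduct_mulVec]
    congr 1
    ext j
    rw [hgX, hg]
    simp [vecMul, dotProduct, hsymm (x j)]
  set A0 := β ⬝ᵥ ((Matrix.of fun i j => k (c i) (c j)) *ᵥ β) with hA0
  have key : ∀ s t : ℝ, 0 ≤ s * s * (A0 - gX ⬝ᵥ u) + 2 * s * t * (g z - w ⬝ᵥ u)
      + t * t * (k z z - w ⬝ᵥ v) := by
    intro s t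
    set a : Fin m → ℝ := -(s • u + t • v) with ha
    have h := kernel_form_nonneg (ι := Fin n ⊕ Fin m ⊕ Unit) k hpsd
      (Sum.elim c (Sum.elim x fun _ : Unit => z)) (Sum.elim (s • β) (Sum.elim a fun _ : Unit => t))
    have hexp : (Sum.elim (s • β) (Sum.elim a fun _ : Unit => t) : Fin n ⊕ Fin m ⊕ Unit → ℝ) ⬝ᵥ
        ((Matrix.of fun i j => k (Sum.elim c (Sum.elim x fun _ : Unit => z) i)
          (Sum.elim c (Sum.elim x fun _ : Unit => z) j)) *ᵥ
          (Sum.elim (s • β) (Sum.elim a fun _ : Unit => t))) =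
        s * s * A0 + a ⬝ᵥ (K *ᵥ a) + t * t * k z z + 2 * s * (gX ⬝ᵥ a)
          + 2 * s * t * g z + 2 * t * (w ⬝ᵥ a) := by
      have e1 : ∑ i, a i * ∑ j, k (x i) (c j) * (s * β j) = s * (gX ⬝ᵥ a) := by
        simp only [dotProduct, hgX, hg, Finset.mul_sum, Finset.sum_mul]
        refine Finset.sum_congr rfl fun i _ => Finset.sum_congr rfl fun j _ => ?_
        ring
      have e2 : ∑ i, s * β i * ∑ j, k (c i) (x j) * a j = s * (gX ⬝ᵥ a) := by
        rw [← hcross]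
        simp only [dotProduct, mulVec, Matrix.of_apply, Finset.mul_sum]
        refine Finset.sum_congr rfl fun i _ => Finset.sum_congr rfl fun j _ => ?_
        ring
      have e3 : ∑ i, s * β i * ∑ j, k (c i) (c j) * (s * β j) = s * s * A0 := by
        simp only [hA0, dotProduct, mulVec, Matrix.of_apply, Finset.mul_sum]
        refine Finset.sum_congr rfl fun i _ => Finset.sum_congr rfl fun j _ => ?_
        ring
      have e4 : ∑ i, a i * ∑ j, k (x i) (x j) * a j = a ⬝ᵥ (K *ᵥ a) := by
        rw [hK]; rfl
      have e5 : ∑ i, s * β i * (k (c i) z * t) = s * t * g z := by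
        rw [hg, Finset.mul_sum]
        refine Finset.sum_congr rfl fun i _ => ?_
        rw [hsymm z]; ring
      have e6 : ∑ i, a i * (k (x i) z * t) = t * (w ⬝ᵥ a) := by
        simp only [dotProduct, Finset.mul_sum, hw]
        refine Finset.sum_congr rfl fun i _ => ?_
        rw [hsymm z]; ring
      have e7 : ∑ i, k z (c i) * (s * β i) = s * g z := by
        rw [hg, Finset.mul_sum]
        refine Finset.sum_congr rfl fun i _ => ?_
        ring
      have e8 : ∑ i, k z (x i) * a i = w ⬝ᵥ a := rfl
      generalize gX ⬝ᵥ a = G1 at *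
      generalize w ⬝ᵥ a = G2 at *
      generalize a ⬝ᵥ (K *ᵥ a) = G3 at *
      simp only [dotProduct, mulVec, Fintype.sum_sum_type, Matrix.of_apply, Sum.elim_inl,
        Sum.elim_inr, Pi.smul_apply, smul_eq_mul, Finset.univ_unique, Finset.sum_singleton,
        mul_add, Finset.sum_add_distrib]
      rw [e1, e2, e3, e4, e5, e6, e7, e8]
      ring
    rw [hexp] at h
    have f1 : gX ⬝ᵥ a = -(s * (gX ⬝ᵥ u) + t * (w ⬝ᵥ u)) := by
      simp [ha, dotProduct_add, dotProduct_smul, hvg]; try ring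
    have f2 : w ⬝ᵥ a = -(s * (w ⬝ᵥ u) + t * (w ⬝ᵥ v)) := by
      simp [ha, dotProduct_add, dotProduct_smul]; try ring
    have f3 : a ⬝ᵥ (K *ᵥ a) = -(s * (gX ⬝ᵥ a) + t * (w ⬝ᵥ a)) := by
      have : K *ᵥ a = -(s • gX + t • w) := by
        rw [ha, mulVec_neg, mulVec_add, mulVec_smul, mulVec_smul, hKu, hKv]
      rw [this, dotProduct_neg, dotProduct_add, dotProduct_smul, dotProduct_smul,
        dotProduct_comm a, dotProduct_comm a]
      rfl
    rw [f3, f1, f2] at h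
    linarith
  generalize A0 - gX ⬝ᵥ u = A at *
  generalize g z - w ⬝ᵥ u = E at *
  generalize k z z - w ⬝ᵥ v = B at *
  have hA : 0 ≤ A := by simpa using key 1 0
  have hB : 0 ≤ B := by simpa using key 0 1
  rw [← Real.sqrt_mul hA]
  apply Real.abs_le_sqrt
  have hd := discrim_le_zero (a := A) (b := 2 * E) (c := B)
    (fun s => by have := key s 1; linarith)
  rw [discrim] at hd
  linarith
end

section
/- Let f: ℝᵈ → ℝᵐ be differentiable at w ∈ ℝᵈ with Jacobian J = Df(w) ∈ ℝ^{m×d}, let Y ∈ ℝᵐ, and define the square loss L₂(w) = (1/(2m))·‖f(w) − Y‖₂². Then for every Δw ∈ ℝᵈ, writing Δf = f(w+Δw) − f(w), the following functional majorisation holds: L₂(w+Δw) − [L₂(w) + ∇L₂(w)ᵀΔw] ≤ (1/m)·‖f(w) − Y‖₂·‖Δf − JΔw‖₂ + (1/(2m))·‖Δf‖₂². -/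
open scoped RealInnerProductSpace

/-- Functional majorisation of the square loss:
for `L₂(w) = (1/(2m))·‖f(w) − Y‖²` with `f` differentiable at `w` with derivative `J`,
the error of the first-order Taylor expansion of `L₂` is at most
`(1/m)‖f(w) − Y‖·‖Δf − JΔw‖ + (1/(2m))‖Δf‖²` where `Δf = f(w+Δw) − f(w)`. -/
theorem square_loss_functional_majorisation {d m : ℕ}
    (f : EuclideanSpace ℝ (Fin d) → EuclideanSpace ℝ (Fin m))
    (w : EuclideanSpace ℝ (Fin d))
    (J : EuclideanSpace ℝ (Fin d) →L[ℝ] EuclideanSpace ℝ (Fin m))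
    (hf : HasFDerivAt f J w)
    (Y : EuclideanSpace ℝ (Fin m))
    (L2 : EuclideanSpace ℝ (Fin d) → ℝ)
    (hL2 : ∀ v, L2 v = (1 / (2 * (m : ℝ))) * ‖f v - Y‖ ^ 2)
    (Δw : EuclideanSpace ℝ (Fin d)) :
    L2 (w + Δw) - (L2 w + fderiv ℝ L2 w Δw)
      ≤ (1 / (m : ℝ)) * ‖f w - Y‖ * ‖(f (w + Δw) - f w) - J Δw‖
        + (1 / (2 * (m : ℝ))) * ‖f (w + Δw) - f w‖ ^ 2 := by
  have hc : (1 / (m : ℝ)) = 2 * (1 / (2 * (m : ℝ))) := by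
    rw [one_div, one_div, mul_inv]; ring
  have hc0 : 0 ≤ 1 / (2 * (m : ℝ)) := by positivity
  rw [hc]
  generalize 1 / (2 * (m : ℝ)) = c at *
  have hfun : L2 = fun v => c * ‖f v - Y‖ ^ 2 := funext hL2
  have hd := ((hf.sub_const Y).norm_sq).const_mul c
  rw [← hfun] at hd
  have hval : fderiv ℝ L2 w Δw = c * (2 * ⟪f w - Y, J Δw⟫) := by
    rw [hd.fderiv]
    simp [inner_sub_left]
  have hcs := real_inner_le_norm (f w - Y) ((f (w + Δw) - f w) - J Δw)
  have hexp : ‖f (w + Δw) - Y‖ ^ 2 = ‖f w - Y‖ ^ 2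
      + 2 * ⟪f w - Y, f (w + Δw) - f w⟫ + ‖f (w + Δw) - f w‖ ^ 2 := by
    rw [← norm_add_sq_real]
    congr 2
    abel
  rw [inner_sub_right] at hcs
  rw [hval, hL2, hL2, hexp]
  have h := mul_le_mul_of_nonneg_left hcs hc0
  linarith
end

section
/- Let f(x; w) = W_L ⋯ W_1 x be a deep linear network of depth L with single output (d_L = 1), with each weight matrix W_l ∈ ℝ^{d_l × d_{l−1}} nonzero, and let F(w) = √d₀·∏_{l=1}^L ‖W_l‖_*. Let x₁,…,x_m ∈ ℝ^{d₀} satisfy ‖xᵢ‖₂ = √d₀ for all i, and let Δw = (ΔW_1,…,ΔW_L) be any weight perturbation. Writing Δf_X ∈ ℝᵐ for the vector with entries f(xᵢ; w+Δw) − f(xᵢ; w), one has: ‖Δf_X‖₂ / √m ≤ F(w) · [ ∏_{l=1}^L (1 + ‖ΔW_l‖_*/‖W_l‖_*) − 1 ]. -/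
/-- The spectral norm (largest singular value) of a real matrix, as the operator norm of
the induced linear map between Euclidean spaces. -/
noncomputable def specNorm {p q : ℕ} (A : Matrix (Fin p) (Fin q) ℝ) : ℝ :=
  ‖LinearMap.toContinuousLinearMap (Matrix.toEuclideanLin A)‖

/-- A deep linear network: `netFwd d W L x = W_{L} ⋯ W_1 x` where the `l`-th weight matrix
(0-indexed) `W l` has dimensions `d (l+1) × d l`. -/
def netFwd (d : ℕ → ℕ) (W : ∀ l : ℕ, Matrix (Fin (d (l + 1))) (Fin (d l)) ℝ) :
    (L : ℕ) → (Fin (d 0) → ℝ) → Fin (d L) → ℝ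
  | 0, x => x
  | L + 1, x => (W L).mulVec (netFwd d W L x)

/-- The Euclidean norm of a vector in `ℝⁿ`. -/
noncomputable def euclNorm {n : ℕ} (v : Fin n → ℝ) : ℝ :=
  Real.sqrt (∑ i, (v i) ^ 2)

theorem euclNorm_eq {n : ℕ} (v : Fin n → ℝ) : euclNorm v = ‖WithLp.toLp 2 v‖ := by
  simp [euclNorm, EuclideanSpace.norm_eq]

theorem specNorm_nonneg {p q : ℕ} (A : Matrix (Fin p) (Fin q) ℝ) : 0 ≤ specNorm A :=
  norm_nonneg _

theorem euclNorm_nonneg {n : ℕ} (v : Fin n → ℝ) : 0 ≤ euclNorm v := Real.sqrt_nonneg _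

theorem specNorm_pos {p q : ℕ} (A : Matrix (Fin p) (Fin q) ℝ) (h : A ≠ 0) :
    0 < specNorm A := by
  unfold specNorm
  rw [norm_pos_iff]
  intro h0
  apply h
  simpa using h0

theorem specNorm_add_le {p q : ℕ} (A B : Matrix (Fin p) (Fin q) ℝ) :
    specNorm (A + B) ≤ specNorm A + specNorm B := by
  unfold specNorm
  rw [map_add, map_add]
  exact norm_add_le _ _

theorem euclNorm_mulVec_le {p q : ℕ} (A : Matrix (Fin p) (Fin q) ℝ) (v : Fin q → ℝ) :
    euclNorm (A.mulVec v) ≤ specNorm A * euclNorm v := by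
  rw [euclNorm_eq, euclNorm_eq]
  exact (LinearMap.toContinuousLinearMap (Matrix.toEuclideanLin A)).le_opNorm (WithLp.toLp 2 v)

theorem euclNorm_add_le {n : ℕ} (u v : Fin n → ℝ) :
    euclNorm (u + v) ≤ euclNorm u + euclNorm v := by
  rw [euclNorm_eq, euclNorm_eq, euclNorm_eq, WithLp.toLp_add]
  exact norm_add_le _ _

theorem net_bound (d : ℕ → ℕ) (W : ∀ l : ℕ, Matrix (Fin (d (l + 1))) (Fin (d l)) ℝ)
    (x : Fin (d 0) → ℝ) (k : ℕ) :
    euclNorm (netFwd d W k x) ≤ (∏ l ∈ Finset.range k, specNorm (W l)) * euclNorm x := by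
  induction k with
  | zero => simp [netFwd]
  | succ k ih =>
    rw [Finset.prod_range_succ, netFwd]
    refine (euclNorm_mulVec_le _ _).trans
      ((mul_le_mul_of_nonneg_left ih (specNorm_nonneg _)).trans (le_of_eq (by ring)))

theorem net_diff (d : ℕ → ℕ) (W D : ∀ l : ℕ, Matrix (Fin (d (l + 1))) (Fin (d l)) ℝ)
    (x : Fin (d 0) → ℝ) (k : ℕ) :
    euclNorm (netFwd d (fun l => W l + D l) k x - netFwd d W k x) ≤
      ((∏ l ∈ Finset.range k, (specNorm (W l) + specNorm (D l)))
        - ∏ l ∈ Finset.range k, specNorm (W l)) * euclNorm x := by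
  induction k with
  | zero => simp [netFwd, euclNorm]
  | succ k ih =>
    have e : netFwd d (fun l => W l + D l) (k+1) x - netFwd d W (k+1) x
        = (W k + D k).mulVec (netFwd d (fun l => W l + D l) k x - netFwd d W k x)
          + (D k).mulVec (netFwd d W k x) := by
      simp only [netFwd, Matrix.mulVec_sub, Matrix.add_mulVec]
      abel
    rw [e, Finset.prod_range_succ, Finset.prod_range_succ]
    refine (euclNorm_add_le _ _).trans ?_
    have h1 := (euclNorm_mulVec_le (W k + D k)
      (netFwd d (fun l => W l + D l) k x - netFwd d W k x)).trans
      ((mul_le_mul_of_nonneg_right (specNorm_add_le _ _) (euclNorm_nonneg _)).trans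
        (mul_le_mul_of_nonneg_left ih
          (add_nonneg (specNorm_nonneg (W k)) (specNorm_nonneg (D k)))))
    have h2 := (euclNorm_mulVec_le (D k) (netFwd d W k x)).trans
      (mul_le_mul_of_nonneg_left (net_bound d W x k) (specNorm_nonneg _))
    refine (add_le_add h1 h2).trans (le_of_eq (by ring))

theorem sum_sq_eq {n : ℕ} (hn : n = 1) (v : Fin n → ℝ) :
    (∑ j, v j) ^ 2 = euclNorm v ^ 2 := by
  subst hn
  rw [euclNorm, Real.sq_sqrt (Finset.sum_nonneg fun i _ => sq_nonneg _)]
  simp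

/-- Architectural perturbation bound for a deep linear network with a
single output (`d L = 1`): on `m` inputs of norm `√d₀`, the projected functional
perturbation satisfies
`‖Δf_X‖₂/√m ≤ F(w)·[∏ₗ(1 + ‖ΔWₗ‖_*/‖Wₗ‖_*) − 1]` with `F(w) = √d₀·∏ₗ‖Wₗ‖_*`. -/
theorem deep_linear_network_perturbation_bound (L : ℕ) (d : ℕ → ℕ) (hdL : d L = 1)
    (W ΔW : ∀ l : ℕ, Matrix (Fin (d (l + 1))) (Fin (d l)) ℝ)
    (hW : ∀ l < L, W l ≠ 0)
    (m : ℕ) (x : Fin m → Fin (d 0) → ℝ)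
    (hx : ∀ i, euclNorm (x i) = Real.sqrt (d 0)) :
    euclNorm (fun i =>
        (∑ j, netFwd d (fun l => W l + ΔW l) L (x i) j) - ∑ j, netFwd d W L (x i) j)
        / Real.sqrt m
      ≤ (Real.sqrt (d 0) * ∏ l ∈ Finset.range L, specNorm (W l)) *
          ((∏ l ∈ Finset.range L, (1 + specNorm (ΔW l) / specNorm (W l))) - 1) := by
  have hprod : (∏ l ∈ Finset.range L, (specNorm (W l) + specNorm (ΔW l)))
      = (∏ l ∈ Finset.range L, specNorm (W l)) *
        ∏ l ∈ Finset.range L, (1 + specNorm (ΔW l) / specNorm (W l)) := by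
    rw [← Finset.prod_mul_distrib]
    refine Finset.prod_congr rfl fun l hl => ?_
    have := (specNorm_pos (W l) (hW l (Finset.mem_range.mp hl))).ne'
    field_simp
  set B := (Real.sqrt (d 0) * ∏ l ∈ Finset.range L, specNorm (W l)) *
          ((∏ l ∈ Finset.range L, (1 + specNorm (ΔW l) / specNorm (W l))) - 1) with hB
  have hB0 : 0 ≤ B := by
    refine mul_nonneg (mul_nonneg (Real.sqrt_nonneg _)
      (Finset.prod_nonneg fun l _ => specNorm_nonneg _)) (sub_nonneg.mpr ?_)
    refine Finset.one_le_prod fun l _ => ?_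
    have := div_nonneg (specNorm_nonneg (ΔW l)) (specNorm_nonneg (W l))
    linarith
  refine div_le_of_le_mul₀ (Real.sqrt_nonneg _) hB0 ?_
  have key : ∀ i, ((∑ j, netFwd d (fun l => W l + ΔW l) L (x i) j)
      - ∑ j, netFwd d W L (x i) j) ^ 2 ≤ B ^ 2 := by
    intro i
    have h := net_diff d W ΔW (x i) L
    rw [hx, hprod] at h
    rw [← Finset.sum_sub_distrib]
    have e := sum_sq_eq hdL (netFwd d (fun l => W l + ΔW l) L (x i) - netFwd d W L (x i))
    simp only [Pi.sub_apply] at e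
    rw [e]
    refine pow_le_pow_left₀ (euclNorm_nonneg _) (h.trans (le_of_eq ?_)) 2
    rw [hB]; ring
  unfold euclNorm
  refine Real.sqrt_le_iff.mpr ⟨mul_nonneg hB0 (Real.sqrt_nonneg _), ?_⟩
  rw [mul_pow, Real.sq_sqrt (Nat.cast_nonneg m)]
  refine (Finset.sum_le_sum fun i _ => key i).trans (le_of_eq ?_)
  simp [mul_comm]
end

section
/- Let Q be a probability measure on ℝᵈ with a log-concave density supported on a convex subset of ℝᵈ of positive Lebesgue measure, with mean μ = E_{w∼Q} w. Let φ: 𝒳 → ℝᵈ be any feature map and consider the linear ensemble of classifiers f_φ(x; w) = wᵀφ(x) with w ∼ Q, and let 𝒟 be a probability distribution on 𝒳 × {−1, +1}. Fix the sign convention sign(t) = +1 if t ≥ 0 and −1 if t < 0. Define the Gibbs error ε_Gibbs = E_{w∼Q} P_{(x,y)∼𝒟}[sign(wᵀφ(x)) ≠ y] and the BPM error ε_BPM = P_{(x,y)∼𝒟}[sign(μᵀφ(x)) ≠ y]. Then ε_BPM ≤ e · ε_Gibbs. -/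
open MeasureTheory
open scoped RealInnerProductSpace

open Set Pointwise ENNReal in
lemma bm_compact (A B : Set ℝ) (hA : IsCompact A) (hB : IsCompact B) (hA' : A.Nonempty)
    (hB' : B.Nonempty) : volume A + volume B ≤ volume (A + B) := by
  obtain ⟨a, ha, hamax⟩ := hA.exists_isGreatest hA'
  obtain ⟨b, hb, hbmin⟩ := hB.exists_isLeast hB'
  have h1 : (b +ᵥ A) ∪ (a +ᵥ B) ⊆ A + B := by
    rintro x (⟨y, hy, rfl⟩ | ⟨y, hy, rfl⟩)
    · simp only [vadd_eq_add]
      rw [add_comm b y]; exact Set.add_mem_add hy hb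
    · exact Set.add_mem_add ha hy
  have h2 : volume ((b +ᵥ A) ∩ (a +ᵥ B)) = 0 := by
    refine measure_mono_null (t := {a + b}) ?_ (by simp)
    rintro x ⟨⟨y, hy, rfl⟩, ⟨z, hz, hyz⟩⟩
    have := hamax hy
    have := hbmin hz
    simp only [vadd_eq_add] at *
    simp only [mem_singleton_iff]
    linarith
  calc volume A + volume B = volume (b +ᵥ A) + volume (a +ᵥ B) := by
        rw [measure_vadd, measure_vadd]
    _ = volume ((b +ᵥ A) ∪ (a +ᵥ B)) := by
        rw [← measure_union_add_inter (b +ᵥ A) (hB.vadd a).measurableSet, h2, add_zero]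
    _ ≤ _ := measure_mono h1

open Set Pointwise ENNReal in
lemma bm_one (A B : Set ℝ) (hA : MeasurableSet A) (hB : MeasurableSet B) (hA' : A.Nonempty)
    (hB' : B.Nonempty) : volume A + volume B ≤ volume (A + B) := by
  obtain ⟨a, ha⟩ := hA'
  obtain ⟨b, hb⟩ := hB'
  rw [hA.measure_eq_iSup_isCompact, hB.measure_eq_iSup_isCompact]
  simp only [iSup_and']
  refine ENNReal.biSup_add_biSup_le' (p := fun K => K ⊆ A ∧ IsCompact K)
    (q := fun K => K ⊆ B ∧ IsCompact K) ⟨∅, by simp⟩ ⟨∅, by simp⟩ ?_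
  rintro K ⟨hK, hKc⟩ L ⟨hL, hLc⟩
  calc volume K + volume L ≤ volume (insert a K) + volume (insert b L) := by
        gcongr <;> exact subset_insert _ _
    _ ≤ volume (insert a K + insert b L) :=
        bm_compact _ _ (hKc.insert a) (hLc.insert b) (insert_nonempty _ _) (insert_nonempty _ _)
    _ ≤ _ := by
        refine measure_mono (Set.add_subset_add ?_ ?_)
        · exact insert_subset ha hK
        · exact insert_subset hb hL

open Set Pointwise ENNReal in
lemma pl_norm (t : ℝ) (ht0 : 0 < t) (ht1 : t < 1) (f g h : ℝ → ℝ≥0∞) (hf : Measurable f)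
    (hg : Measurable g) (hh : Measurable h) (hf1 : ⨆ x, f x = 1) (hg1 : ⨆ x, g x = 1)
    (H : ∀ x y, f x ^ (1 - t) * g y ^ t ≤ h ((1 - t) * x + t * y)) :
    ENNReal.ofReal (1 - t) * (∫⁻ x, f x) + ENNReal.ofReal t * (∫⁻ x, g x) ≤ ∫⁻ x, h x := by
  have key : ∀ f : ℝ → ℝ≥0∞, Measurable f → (∀ x, f x ≤ 1) →
      ∫⁻ x, f x = ∫⁻ s in Ioi (0:ℝ), volume {x | s < (f x).toReal} := by
    intro f hf hf1
    rw [← lintegral_eq_lintegral_meas_lt volume (Filter.Eventually.of_forall fun x => by simp)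
      hf.ennreal_toReal.aemeasurable]
    refine lintegral_congr fun x => ?_
    rw [ENNReal.ofReal_toReal]
    exact ne_top_of_le_ne_top (by simp) (hf1 x)
  have hfle : ∀ x, f x ≤ 1 := fun x => hf1 ▸ le_iSup f x
  have hgle : ∀ x, g x ≤ 1 := fun x => hg1 ▸ le_iSup g x
  have hhm : ∫⁻ x, min (h x) 1 ≤ ∫⁻ x, h x := lintegral_mono fun x => min_le_left _ _
  refine le_trans ?_ hhm
  rw [key f hf hfle, key g hg hgle, key (fun x => min (h x) 1) (hh.min measurable_const)
    (fun x => min_le_right _ _)]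
  have mset : ∀ f : ℝ → ℝ≥0∞, Measurable f → ∀ s : ℝ, MeasurableSet {x | s < (f x).toReal} :=
    fun f hf s => measurableSet_lt measurable_const hf.ennreal_toReal
  have manti : ∀ f : ℝ → ℝ≥0∞, Measurable fun s : ℝ => volume {x | s < (f x).toReal} := by
    intro f
    refine Antitone.measurable fun a b hab => measure_mono fun x hx => ?_
    exact lt_of_le_of_lt hab hx
  rw [← lintegral_const_mul _ (manti f), ← lintegral_const_mul _ (manti g),
    ← lintegral_add_left ((manti f).const_mul _)]
  refine setLIntegral_mono' measurableSet_Ioi fun s hs => ?_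
  have hs0 : 0 < s := hs
  have sm : ∀ (c : ℝ), 0 < c → ∀ A : Set ℝ, ENNReal.ofReal c * volume A = volume (c • A) := by
    intro c hc A
    rw [Measure.addHaar_smul]; simp [abs_of_pos hc]
  by_cases hs1 : s < 1
  · have ne : ∀ f : ℝ → ℝ≥0∞, (∀ x, f x ≤ 1) → ⨆ x, f x = 1 → {x | s < (f x).toReal}.Nonempty := by
      intro f hfle hf
      have : ENNReal.ofReal s < ⨆ x, f x := by rw [hf]; simpa using hs1
      obtain ⟨x, hx⟩ := lt_iSup_iff.1 this
      exact ⟨x, (ENNReal.ofReal_lt_iff_lt_toReal hs0.le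
        (ne_top_of_le_ne_top (by simp) (hfle x))).1 hx⟩
    rw [sm _ (by linarith), sm _ ht0]
    refine (bm_one _ _ ((mset f hf s).const_smul₀ _) ((mset g hg s).const_smul₀ _)
      ((ne f hfle hf1).smul_set) ((ne g hgle hg1).smul_set)).trans (measure_mono ?_)
    rintro _ ⟨_, ⟨x, hx, rfl⟩, _, ⟨y, hy, rfl⟩, rfl⟩
    simp only [mem_ofPred_eq, smul_eq_mul] at hx hy ⊢
    have h2 : f x ^ (1 - t) * g y ^ t ≤ 1 := by
      have a1 := ENNReal.rpow_le_one (hfle x) (by linarith : 0 ≤ 1 - t)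
      have a2 := ENNReal.rpow_le_one (hgle y) ht0.le
      exact mul_le_one' a1 a2
    have h3 := le_min (H x y) h2
    refine lt_of_lt_of_le ?_ (ENNReal.toReal_mono (by simp) h3)
    rw [ENNReal.toReal_mul, ← ENNReal.toReal_rpow, ← ENNReal.toReal_rpow]
    calc s = s ^ (1 - t) * s ^ t := by rw [← Real.rpow_add hs0]; simp
      _ < _ := by
        refine mul_lt_mul'' (Real.rpow_lt_rpow hs0.le hx (by linarith))
          (Real.rpow_lt_rpow hs0.le hy ht0) (by positivity) (by positivity)
  · have em : ∀ f : ℝ → ℝ≥0∞, (∀ x, f x ≤ 1) → {x | s < (f x).toReal} = ∅ := by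
      intro f hf
      ext x
      have : (f x).toReal ≤ 1 := by simpa using ENNReal.toReal_mono (by simp) (hf x)
      simp; linarith
    rw [em f hfle, em g hgle]; simp

open ENNReal in
lemma ennreal_amgm (t : ℝ) (ht0 : 0 < t) (ht1 : t < 1) (a b : ℝ≥0∞) :
    a ^ (1 - t) * b ^ t ≤ ENNReal.ofReal (1 - t) * a + ENNReal.ofReal t * b := by
  have h1 : 0 < 1 - t := by linarith
  by_cases ha : a = ∞
  · rw [ha, ENNReal.mul_top (by simpa using h1)]; simp
  by_cases hb : b = ∞
  · rw [hb, ENNReal.mul_top (by simpa using ht0)]; simp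
  lift a to NNReal using ha
  lift b to NNReal using hb
  have := NNReal.geom_mean_le_arith_mean2_weighted (1 - t).toNNReal t.toNNReal a b
    (by rw [← Real.toNNReal_add h1.le ht0.le]; simp)
  rw [Real.coe_toNNReal _ h1.le, Real.coe_toNNReal _ ht0.le] at this
  rw [← ENNReal.coe_rpow_of_nonneg _ h1.le, ← ENNReal.coe_rpow_of_nonneg _ ht0.le]
  simp only [ENNReal.ofReal]
  exact_mod_cast this

open ENNReal in
lemma pl_bdd (t : ℝ) (ht0 : 0 < t) (ht1 : t < 1) (f g h : ℝ → ℝ≥0∞) (hf : Measurable f)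
    (hg : Measurable g) (hh : Measurable h) (hf1 : ⨆ x, f x ≠ ∞) (hg1 : ⨆ x, g x ≠ ∞)
    (H : ∀ x y, f x ^ (1 - t) * g y ^ t ≤ h ((1 - t) * x + t * y)) :
    (∫⁻ x, f x) ^ (1 - t) * (∫⁻ x, g x) ^ t ≤ ∫⁻ x, h x := by
  have h1 : 0 < 1 - t := by linarith
  by_cases hA : ⨆ x, f x = 0
  · have : ∀ x, f x = 0 := fun x => by simpa [hA] using le_iSup f x
    simp [this, ENNReal.zero_rpow_of_pos h1]
  by_cases hB : ⨆ x, g x = 0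
  · have : ∀ x, g x = 0 := fun x => by simpa [hB] using le_iSup g x
    simp [this, ENNReal.zero_rpow_of_pos ht0]
  set A := ⨆ x, f x with hAdef
  set B := ⨆ x, g x with hBdef
  set C := (A⁻¹) ^ (1 - t) * (B⁻¹) ^ t with hC
  have hC0 : C ≠ 0 := by
    rw [hC]; simp [ENNReal.rpow_eq_zero_iff, hf1, hg1, hA, hB]
  have hCt : C ≠ ∞ := by
    refine ENNReal.mul_ne_top ?_ ?_
    · exact ENNReal.rpow_ne_top_of_nonneg h1.le (by simpa using hA)
    · exact ENNReal.rpow_ne_top_of_nonneg ht0.le (by simpa using hB)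
  have := pl_norm t ht0 ht1 (fun x => A⁻¹ * f x) (fun x => B⁻¹ * g x) (fun x => C * h x)
    (hf.const_mul _) (hg.const_mul _) (hh.const_mul _)
    (by rw [← ENNReal.mul_iSup, ← hAdef, ENNReal.inv_mul_cancel hA hf1])
    (by rw [← ENNReal.mul_iSup, ← hBdef, ENNReal.inv_mul_cancel hB hg1])
    (by
      intro x y
      rw [ENNReal.mul_rpow_of_nonneg _ _ h1.le, ENNReal.mul_rpow_of_nonneg _ _ ht0.le, hC,
        mul_mul_mul_comm]
      gcongr
      exact H x y)
  have h3 := (ennreal_amgm t ht0 ht1 _ _).trans this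
  rw [lintegral_const_mul _ hf, lintegral_const_mul _ hg, lintegral_const_mul _ hh,
    ENNReal.mul_rpow_of_nonneg _ _ h1.le, ENNReal.mul_rpow_of_nonneg _ _ ht0.le,
    mul_mul_mul_comm, ← hC] at h3
  exact (ENNReal.mul_le_mul_iff_right hC0 hCt).1 h3

open ENNReal in
lemma pl_one (t : ℝ) (ht0 : 0 < t) (ht1 : t < 1) (f g h : ℝ → ℝ≥0∞) (hf : Measurable f)
    (hg : Measurable g) (hh : Measurable h)
    (H : ∀ x y, f x ^ (1 - t) * g y ^ t ≤ h ((1 - t) * x + t * y)) :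
    (∫⁻ x, f x) ^ (1 - t) * (∫⁻ x, g x) ^ t ≤ ∫⁻ x, h x := by
  have h1 : 0 < 1 - t := by linarith
  have key : ∀ f : ℝ → ℝ≥0∞, Measurable f →
      ∫⁻ x, f x = ⨆ n : ℕ, ∫⁻ x, min (f x) n := by
    intro f hf
    rw [← lintegral_iSup (fun n => hf.min measurable_const)]
    · refine lintegral_congr fun x => ?_
      refine le_antisymm ?_ (iSup_le fun n => min_le_left _ _)
      refine le_of_forall_lt fun c hc => ?_
      obtain ⟨n, hn⟩ := ENNReal.exists_nat_gt (ne_top_of_lt hc)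
      exact lt_of_lt_of_le (lt_min hc hn) (le_iSup (fun n : ℕ => min (f x) n) n)
    · intro a b hab x
      exact min_le_min le_rfl (by exact_mod_cast hab)
  have tend : ∀ f : ℝ → ℝ≥0∞, Measurable f → Filter.Tendsto (fun n : ℕ => ∫⁻ x, min (f x) n)
      Filter.atTop (nhds (∫⁻ x, f x)) := by
    intro f hf
    rw [key f hf]
    refine tendsto_atTop_iSup fun a b hab => lintegral_mono fun x => ?_
    exact min_le_min le_rfl (by exact_mod_cast hab)
  have bnd : ∀ n : ℕ, (∫⁻ x, min (f x) n) ^ (1 - t) * (∫⁻ x, min (g x) n) ^ t ≤ ∫⁻ x, h x := by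
    intro n
    refine pl_bdd t ht0 ht1 _ _ h (hf.min measurable_const) (hg.min measurable_const) hh
      ?_ ?_ ?_
    · exact ne_top_of_le_ne_top (ENNReal.natCast_ne_top n) (iSup_le fun x => min_le_right _ _)
    · exact ne_top_of_le_ne_top (ENNReal.natCast_ne_top n) (iSup_le fun x => min_le_right _ _)
    · intro x y
      refine le_trans ?_ (H x y)
      gcongr <;> exact min_le_left _ _
  by_cases hf0 : ∫⁻ x, f x = 0
  · simp [hf0, h1]
  by_cases hg0 : ∫⁻ x, g x = 0
  · simp [hg0, ht0]
  refine le_of_tendsto' (ENNReal.Tendsto.mul ((tend f hf).ennrpow_const (1 - t)) (Or.inl ?_)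
    ((tend g hg).ennrpow_const t) (Or.inl ?_)) bnd
  · simp [ENNReal.rpow_eq_zero_iff, hf0, ht1.le]
  · simp [ENNReal.rpow_eq_zero_iff, hg0, ht0.le]

open ENNReal in
lemma pl_pi (t : ℝ) (ht0 : 0 < t) (ht1 : t < 1) (n : ℕ) : ∀ (f g h : (Fin n → ℝ) → ℝ≥0∞)
    (_ : Measurable f) (_ : Measurable g) (_ : Measurable h)
    (_ : ∀ x y, f x ^ (1 - t) * g y ^ t ≤ h ((1 - t) • x + t • y)),
    (∫⁻ x, f x) ^ (1 - t) * (∫⁻ x, g x) ^ t ≤ ∫⁻ x, h x := by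
  induction n with
  | zero =>
    intro f g h hf hg hh H
    rw [volume_pi, Measure.pi_of_empty (fun _ : Fin 0 => (volume : Measure ℝ)) 0]
    rw [lintegral_dirac, lintegral_dirac, lintegral_dirac]
    simpa using H 0 0
  | succ n ih =>
    intro f g h hf hg hh H
    set e := (MeasurableEquiv.piFinSuccAbove (fun _ : Fin (n+1) => ℝ) 0).symm with he
    have hmp : MeasurePreserving e := (volume_preserving_piFinSuccAbove (fun _ : Fin (n+1) => ℝ) 0).symm _
    have key : ∀ f : (Fin (n+1) → ℝ) → ℝ≥0∞, Measurable f →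
        ∫⁻ x, f x = ∫⁻ a : ℝ, ∫⁻ x : Fin n → ℝ, f (e (a, x)) := by
      intro f hf
      rw [← hmp.lintegral_comp hf, Measure.volume_eq_prod, lintegral_prod (fun z => f (e z)) (hf.comp e.measurable).aemeasurable]
    have meas : ∀ f : (Fin (n+1) → ℝ) → ℝ≥0∞, Measurable f →
        Measurable fun a : ℝ => ∫⁻ x : Fin n → ℝ, f (e (a, x)) := by
      intro f hf
      exact (hf.comp e.measurable).lintegral_prod_right'
    rw [key f hf, key g hg, key h hh]
    refine pl_one t ht0 ht1 _ _ _ (meas f hf) (meas g hg) (meas h hh) fun a b => ?_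
    refine ih _ _ _ (by fun_prop) (by fun_prop) (by fun_prop) fun x y => ?_
    refine (H _ _).trans (le_of_eq ?_)
    congr 1
    funext i
    refine Fin.cases ?_ (fun j => ?_) i <;>
    simp [he, MeasurableEquiv.piFinSuccAbove, Fin.insertNthEquiv]

open Set in
lemma grun_one (ν : Measure ℝ) [IsProbabilityMeasure ν] (hint : Integrable (fun r : ℝ => r) ν)
    (hlc : ∀ a b t : ℝ, 0 < t → t < 1 →
      ν (Ici a) ^ (1 - t) * ν (Ici b) ^ t ≤ ν (Ici ((1 - t) * a + t * b))) :
    ENNReal.ofReal (Real.exp (-1)) ≤ ν (Ici (∫ r, r ∂ν)) := by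
  set m := ∫ r, r ∂ν with hm
  set G : ℝ → ℝ := fun r => ν.real (Ici r) with hG
  have hGanti : Antitone G := fun a b hab => measureReal_mono (Ici_subset_Ici.2 hab)
  have hGm : Measurable G := hGanti.measurable
  have hG0 : ∀ r, 0 ≤ G r := fun r => measureReal_nonneg
  have hG1 : ∀ r, G r ≤ 1 := fun r => measureReal_le_one
  have hlcR : ∀ a b t : ℝ, 0 < t → t < 1 → G a ^ (1 - t) * G b ^ t ≤ G ((1 - t) * a + t * b) := by
    intro a b t h0 h1
    have := ENNReal.toReal_mono (measure_ne_top _ _) (hlc a b t h0 h1)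
    rwa [ENNReal.toReal_mul, ← ENNReal.toReal_rpow, ← ENNReal.toReal_rpow] at this
  have tail : ∀ u : ℝ, ν {r | G r < u} ≤ ENNReal.ofReal u := by
    intro u
    have hJ : MeasurableSet {r | G r < u} := measurableSet_lt hGm measurable_const
    rw [hJ.measure_eq_iSup_isCompact]
    refine iSup_le fun K => iSup_le fun hK => iSup_le fun hKc => ?_
    rcases K.eq_empty_or_nonempty with rfl | hne
    · simp
    obtain ⟨r, hr, hmin⟩ := hKc.exists_isLeast hne
    calc ν K ≤ ν (Ici r) := measure_mono fun x hx => hmin hx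
      _ = ENNReal.ofReal (G r) := by rw [hG]; simp
      _ ≤ _ := ENNReal.ofReal_le_ofReal (le_of_lt (hK hr))
  have hpos : ∀ᵐ r ∂ν, 0 < G r := by
    rw [ae_iff]
    refine le_antisymm (ENNReal.le_of_forall_pos_le_add fun ε hε _ => ?_) (zero_le)
    rw [zero_add]
    have := tail ε
    simp only [ENNReal.ofReal_coe_nnreal] at this
    refine le_trans (measure_mono fun r hr => ?_) this
    simp only [mem_ofPred_eq, not_lt] at hr ⊢
    exact lt_of_le_of_lt hr (by exact_mod_cast hε)
  set I : Set ℝ := {r | 0 < G r} with hI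
  by_cases hex : ∃ r ∈ I, m < r
  swap
  · push Not at hex
    have hle : ∀ᵐ r ∂ν, r ≤ m := hpos.mono fun r hr => hex r hr
    have hi : ∫ r, (m - r) ∂ν = 0 := by
      rw [integral_sub (integrable_const _) hint]; simp [hm]
    have hsi : Integrable (fun r => m - r) ν := (integrable_const _).sub hint
    rw [integral_eq_zero_iff_of_nonneg_ae (hle.mono fun r hr => by simpa using hr) hsi] at hi
    have : ν (Ici m) = 1 := by
      rw [prob_compl_eq_zero_iff measurableSet_Ici |>.symm]
      refine (ae_iff (p := fun r => r ∈ Ici m)).1 ?_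
      filter_upwards [hi] with r hr
      simp only [Pi.zero_apply] at hr
      simp only [mem_Ici]; linarith
    rw [this]
    simp
  obtain ⟨r0, hr0, hmr0⟩ := hex
  have hmint : m ∈ interior I := by
    rw [mem_interior]
    refine ⟨Iio r0, fun r hr => ?_, isOpen_Iio, hmr0⟩
    exact lt_of_lt_of_le hr0 (hGanti (le_of_lt hr))
  set L : ℝ → ℝ := fun r => - Real.log (G r) with hL
  have hconv : ConvexOn ℝ I L := by
    rw [convexOn_iff_forall_pos]
    have key : ∀ a ∈ I, ∀ b ∈ I, ∀ α β : ℝ, 0 < α → 0 < β → α + β = 1 →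
        0 < G a ^ α * G b ^ β ∧ G a ^ α * G b ^ β ≤ G (α * a + β * b) := by
      intro a ha b hb α β hα hβ h
      have ha' : 0 < G a := ha
      have hb' : 0 < G b := hb
      refine ⟨by positivity, ?_⟩
      have := hlcR a b β hβ (by linarith)
      rwa [show 1 - β = α by linarith] at this
    refine ⟨?_, ?_⟩
    · rw [convex_iff_forall_pos]
      intro a ha b hb α β hα hβ h
      have := key a ha b hb α β hα hβ h
      exact this.1.trans_le this.2
    · intro a ha b hb α β hα hβ h
      have := key a ha b hb α β hα hβ h
      have ha' : 0 < G a := ha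
      have hb' : 0 < G b := hb
      have h2 := Real.log_le_log this.1 this.2
      rw [Real.log_mul (by positivity) (by positivity), Real.log_rpow ha', Real.log_rpow hb'] at h2
      simp only [hL, smul_eq_mul]
      linarith
  set c := derivWithin L (Ioi m) m
  have hsup : ∀ r ∈ I, L m + c * (r - m) ≤ L r := by
    intro r hr
    rcases lt_trichotomy m r with h | h | h
    · have := hconv.rightDeriv_le_slope_of_mem_interior hmint hr h
      rw [slope_def_field, le_div_iff₀ (by linarith)] at this
      linarith
    · simp [h]
    · have := (hconv.slope_le_leftDeriv_of_mem_interior hr hmint h).trans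
        (hconv.leftDeriv_le_rightDeriv_of_mem_interior hmint)
      rw [slope_def_field, div_le_iff₀ (by linarith)] at this
      linarith
  have hLm : Measurable L := (Real.measurable_log.comp hGm).neg
  have hL0 : ∀ r, 0 ≤ L r := fun r => by
    have := Real.log_nonpos (hG0 r) (hG1 r)
    simp only [hL]; linarith
  have hlin : ∫⁻ r, ENNReal.ofReal (L r) ∂ν ≤ 1 := by
    rw [lintegral_eq_lintegral_meas_lt ν (Filter.Eventually.of_forall hL0) hLm.aemeasurable]
    calc ∫⁻ s in Ioi (0:ℝ), ν {r | s < L r} ≤ ∫⁻ s in Ioi (0:ℝ), ENNReal.ofReal (Real.exp (-s)) := by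
          refine setLIntegral_mono' measurableSet_Ioi fun s hs => ?_
          refine le_trans (measure_mono fun r hr => ?_) (tail _)
          simp only [mem_ofPred_eq, hL] at hr ⊢
          rcases (hG0 r).eq_or_lt with h | h
          · rw [← h]; positivity
          · rw [← Real.log_lt_iff_lt_exp h]; linarith
      _ = ENNReal.ofReal (∫ s in Ioi (0:ℝ), Real.exp (-s)) := by
          rw [ofReal_integral_eq_lintegral_ofReal]
          · exact integrableOn_exp_neg_Ioi 0
          · exact Filter.Eventually.of_forall fun s => (Real.exp_pos _).le
      _ = 1 := by rw [integral_exp_neg_Ioi_zero]; simp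
  have hLint : Integrable L ν := by
    refine ⟨hLm.aestronglyMeasurable, ?_⟩
    rw [hasFiniteIntegral_iff_ofReal (Filter.Eventually.of_forall hL0)]
    exact lt_of_le_of_lt hlin (by simp)
  have h1 : ∫ r, L r ∂ν ≤ 1 := by
    rw [integral_eq_lintegral_of_nonneg_ae (Filter.Eventually.of_forall hL0)
      hLm.aestronglyMeasurable]
    simpa using ENNReal.toReal_mono (by simp) hlin
  have hci : Integrable (fun r => c * (r - m)) ν := (hint.sub (integrable_const m)).const_mul c
  have h2 : ∫ r, (L m + c * (r - m)) ∂ν ≤ ∫ r, L r ∂ν :=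
    integral_mono_ae ((integrable_const _).add hci) hLint (hpos.mono hsup)
  rw [integral_add (integrable_const _) hci, integral_const_mul,
    integral_sub hint (integrable_const _)] at h2
  simp only [integral_const, probReal_univ, smul_eq_mul, one_mul, ← hm, sub_self, mul_zero,
    add_zero] at h2
  have hmI : m ∈ I := interior_subset hmint
  have hGmpos : 0 < G m := hmI
  have h3 : Real.exp (-1) ≤ G m := by
    rw [← Real.le_log_iff_exp_le hGmpos]
    have : L m ≤ 1 := h2.trans h1
    simp only [hL] at this
    linarith
  calc ENNReal.ofReal (Real.exp (-1)) ≤ ENNReal.ofReal (G m) := ENNReal.ofReal_le_ofReal h3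
    _ = _ := by rw [hG]; simp

open Set ENNReal in
lemma pl_euclid {d : ℕ} (t : ℝ) (ht0 : 0 < t) (ht1 : t < 1)
    (f g h : EuclideanSpace ℝ (Fin d) → ℝ≥0∞)
    (hf : Measurable f) (hg : Measurable g) (hh : Measurable h)
    (H : ∀ x y, f x ^ (1 - t) * g y ^ t ≤ h ((1 - t) • x + t • y)) :
    (∫⁻ x, f x) ^ (1 - t) * (∫⁻ x, g x) ^ t ≤ ∫⁻ x, h x := by
  have hmp := PiLp.volume_preserving_toLp (Fin d)
  rw [← hmp.lintegral_comp hf, ← hmp.lintegral_comp hg, ← hmp.lintegral_comp hh]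
  refine pl_pi t ht0 ht1 d _ _ _ (hf.comp hmp.measurable) (hg.comp hmp.measurable)
    (hh.comp hmp.measurable) fun x y => ?_
  simpa using H (WithLp.toLp 2 x) (WithLp.toLp 2 y)

open Set ENNReal in
lemma grun_meas {d : ℕ} (Q : Measure (EuclideanSpace ℝ (Fin d))) [IsProbabilityMeasure Q]
    (p : EuclideanSpace ℝ (Fin d) → ℝ) (hp0 : ∀ v, 0 ≤ p v) (hpm : Measurable p)
    (hQ : Q = volume.withDensity fun v => ENNReal.ofReal (p v))
    (hlc : ∀ u v, ∀ t : ℝ, 0 < t → t < 1 →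
      p u ^ (1 - t) * p v ^ t ≤ p ((1 - t) • u + t • v))
    (hint : Integrable (fun v => v) Q) (x : EuclideanSpace ℝ (Fin d)) :
    ENNReal.ofReal (Real.exp (-1)) ≤ Q {w | ⟪∫ v, v ∂Q, x⟫ ≤ ⟪w, x⟫} := by
  have hX : Measurable fun w : EuclideanSpace ℝ (Fin d) => ⟪w, x⟫ := by fun_prop
  have hXi : Integrable (fun w : EuclideanSpace ℝ (Fin d) => ⟪w, x⟫) Q := hint.inner_const x
  have : IsProbabilityMeasure (Q.map fun w => ⟪w, x⟫) :=
    Measure.isProbabilityMeasure_map hX.aemeasurable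
  have key := grun_one (Q.map fun w => ⟪w, x⟫)
    ((integrable_map_measure (by fun_prop) hX.aemeasurable).2 hXi) ?_
  · rw [integral_map hX.aemeasurable (by fun_prop), Measure.map_apply hX measurableSet_Ici] at key
    have h2 : ∫ w, ⟪w, x⟫ ∂Q = ⟪∫ v, v ∂Q, x⟫ := by
      rw [real_inner_comm, ← integral_inner (𝕜 := ℝ) hint x]
      exact integral_congr_ae (Filter.Eventually.of_forall fun w => real_inner_comm _ _)
    rw [h2] at key
    exact key
  · intro a b t ht0 ht1
    have hms : ∀ a : ℝ, MeasurableSet ((fun w => ⟪w, x⟫) ⁻¹' Ici a) := fun a => hX measurableSet_Ici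
    have hap : ∀ a : ℝ, (Q.map fun w => ⟪w, x⟫) (Ici a) =
        ∫⁻ w, ((fun w => ⟪w, x⟫) ⁻¹' Ici a).indicator (fun v => ENNReal.ofReal (p v)) w := by
      intro a
      rw [Measure.map_apply hX measurableSet_Ici, lintegral_indicator (hms a), hQ,
        withDensity_apply _ (hms a)]
    have hmi : ∀ a : ℝ, Measurable
        (((fun w => ⟪w, x⟫) ⁻¹' Ici a).indicator (fun v => ENNReal.ofReal (p v))) :=
      fun a => (hpm.ennreal_ofReal).indicator (hms a)
    rw [hap, hap, hap]
    refine pl_euclid t ht0 ht1 _ _ _ (hmi _) (hmi _) (hmi _) fun u v => ?_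
    have h1 : 0 < 1 - t := by linarith
    by_cases hu : u ∈ ((fun w => ⟪w, x⟫) ⁻¹' Ici a)
    swap
    · rw [indicator_of_notMem hu, ENNReal.zero_rpow_of_pos h1]; simp
    by_cases hv : v ∈ ((fun w => ⟪w, x⟫) ⁻¹' Ici b)
    swap
    · rw [indicator_of_notMem hv, ENNReal.zero_rpow_of_pos ht0]; simp
    have huv : (1 - t) • u + t • v ∈ ((fun w => ⟪w, x⟫) ⁻¹' Ici ((1 - t) * a + t * b)) := by
      simp only [mem_preimage, mem_Ici, inner_add_left, real_inner_smul_left] at hu hv ⊢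
      nlinarith
    rw [indicator_of_mem hu, indicator_of_mem hv, indicator_of_mem huv,
      ENNReal.ofReal_rpow_of_nonneg (hp0 u) h1.le, ENNReal.ofReal_rpow_of_nonneg (hp0 v) ht0.le,
      ← ENNReal.ofReal_mul (by have := hp0 u; positivity)]
    exact ENNReal.ofReal_le_ofReal (hlc u v t ht0 ht1)

open Set ENNReal in
lemma grun_gen {d : ℕ} (Q : Measure (EuclideanSpace ℝ (Fin d))) [IsProbabilityMeasure Q]
    (q : EuclideanSpace ℝ (Fin d) → ℝ) (hq0 : ∀ v, 0 ≤ q v)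
    (hQq : Q = volume.withDensity fun v => ENNReal.ofReal (q v))
    (S : Set (EuclideanSpace ℝ (Fin d)))
    (hSconv : Convex ℝ S)
    (hsupp : ∀ v ∉ S, q v = 0)
    (hlogconc : ∀ u ∈ S, ∀ v ∈ S, ∀ t : ℝ, 0 ≤ t → t ≤ 1 →
      q u ^ (1 - t) * q v ^ t ≤ q ((1 - t) • u + t • v))
    (hint : Integrable (fun v => v) Q) (x : EuclideanSpace ℝ (Fin d)) :
    ENNReal.ofReal (Real.exp (-1)) ≤ Q {w | ⟪∫ v, v ∂Q, x⟫ ≤ ⟪w, x⟫} := by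
  set T : Set (EuclideanSpace ℝ (Fin d)) := {v | 0 < q v} with hT
  have hTS : ∀ v ∈ T, v ∈ S := fun v hv => by
    by_contra h
    have hv' : 0 < q v := hv
    rw [hsupp v h] at hv'
    exact lt_irrefl _ hv'
  have key : ∀ a ∈ T, ∀ b ∈ T, ∀ α β : ℝ, 0 < α → 0 < β → α + β = 1 →
      0 < q a ^ α * q b ^ β ∧ q a ^ α * q b ^ β ≤ q (α • a + β • b) := by
    intro a ha b hb α β hα hβ h
    have ha' : 0 < q a := ha
    have hb' : 0 < q b := hb
    refine ⟨by positivity, ?_⟩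
    have := hlogconc a (hTS a ha) b (hTS b hb) β hβ.le (by linarith)
    rwa [show 1 - β = α by linarith] at this
  have hTconv : Convex ℝ T := by
    rw [convex_iff_forall_pos]
    intro a ha b hb α β hα hβ h
    have := key a ha b hb α β hα hβ h
    exact this.1.trans_le this.2
  have hconc : ConcaveOn ℝ T fun v => Real.log (q v) := by
    rw [concaveOn_iff_forall_pos]
    refine ⟨hTconv, ?_⟩
    intro a ha b hb α β hα hβ h
    have := key a ha b hb α β hα hβ h
    have ha' : 0 < q a := ha
    have hb' : 0 < q b := hb
    have h2 := Real.log_le_log this.1 this.2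
    rw [Real.log_mul (by positivity) (by positivity), Real.log_rpow ha', Real.log_rpow hb'] at h2
    simpa using h2
  have hcont : ContinuousOn q (interior T) := by
    refine (hconc.continuousOn_interior.rexp).congr fun v hv => ?_
    exact (Real.exp_log (interior_subset hv : v ∈ T)).symm
  set p := (interior T).indicator q with hp
  have hpm : Measurable p := by
    classical
    rw [hp, ← Set.piecewise_eq_indicator]
    exact hcont.measurable_piecewise continuousOn_const isOpen_interior.measurableSet
  have hpq : p =ᵐ[volume] q := by
    have := hTconv.addHaar_frontier volume
    rw [measure_eq_zero_iff_ae_notMem] at this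
    filter_upwards [this] with v hv
    by_cases h : v ∈ interior T
    · rw [hp, indicator_of_mem h]
    · rw [hp, indicator_of_notMem h]
      by_contra h0
      refine hv ⟨subset_closure ?_, h⟩
      exact lt_of_le_of_ne (hq0 v) h0
  refine grun_meas Q p (fun v => indicator_nonneg (fun v _ => hq0 v) v) hpm ?_ ?_ hint x
  · rw [hQq]
    refine withDensity_congr_ae ?_
    filter_upwards [hpq] with v hv
    rw [hv]
  · intro u v t ht0 ht1
    have h1 : 0 < 1 - t := by linarith
    by_cases hu : u ∈ interior T
    swap
    · rw [hp, indicator_of_notMem hu, Real.zero_rpow h1.ne', zero_mul]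
      exact indicator_nonneg (fun v _ => hq0 v) _
    by_cases hv : v ∈ interior T
    swap
    · rw [hp, indicator_of_notMem hv, Real.zero_rpow ht0.ne', mul_zero]
      exact indicator_nonneg (fun v _ => hq0 v) _
    have huv := hTconv.interior hu hv h1.le ht0.le (by linarith)
    rw [hp, indicator_of_mem hu, indicator_of_mem hv, indicator_of_mem huv]
    exact (key u (interior_subset hu) v (interior_subset hv) _ _ h1 ht0 (by linarith)).2

/-- Pessimistic Gibbs–BPM: for an ensemble of linear classifiers
`x ↦ sign(wᵀφ(x))` with `w ∼ Q`, where `Q` has a log-concave density (w.r.t. Lebesgue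
measure) supported on a convex set of positive measure and mean `μ`, the error of the
BPM classifier `x ↦ sign(μᵀφ(x))` is at most `e` times the Gibbs error. -/
theorem gibbs_bpm_pessimistic {d : ℕ} {𝒳 : Type*} [MeasurableSpace 𝒳]
    (Q : Measure (EuclideanSpace ℝ (Fin d))) [IsProbabilityMeasure Q]
    (q : EuclideanSpace ℝ (Fin d) → ℝ) (hq0 : ∀ v, 0 ≤ q v)
    (hQq : Q = volume.withDensity fun v => ENNReal.ofReal (q v))
    (S : Set (EuclideanSpace ℝ (Fin d)))
    (hSconv : Convex ℝ S)
    (hSpos : 0 < volume S)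
    (hsupp : ∀ v ∉ S, q v = 0)
    (hlogconc : ∀ u ∈ S, ∀ v ∈ S, ∀ t : ℝ, 0 ≤ t → t ≤ 1 →
      q u ^ (1 - t) * q v ^ t ≤ q ((1 - t) • u + t • v))
    (hint : Integrable (fun v => v) Q)
    (μ : EuclideanSpace ℝ (Fin d)) (hμ : μ = ∫ v, v ∂Q)
    (φ : 𝒳 → EuclideanSpace ℝ (Fin d)) (hφ : Measurable φ)
    (D : Measure (𝒳 × ℝ)) [IsProbabilityMeasure D]
    (hD : ∀ᵐ p ∂D, p.2 = 1 ∨ p.2 = -1)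
    (sgn : ℝ → ℝ) (hsgn : ∀ t : ℝ, sgn t = if t < 0 then (-1 : ℝ) else 1) :
    D {p : 𝒳 × ℝ | sgn ⟪μ, φ p.1⟫ ≠ p.2}
      ≤ ENNReal.ofReal (Real.exp 1) *
          (Q.prod D) {z : EuclideanSpace ℝ (Fin d) × (𝒳 × ℝ) | sgn ⟪z.1, φ z.2.1⟫ ≠ z.2.2} := by
  have hsm : Measurable sgn := by
    have : sgn = fun t => if t < 0 then (-1 : ℝ) else 1 := funext hsgn
    rw [this]
    exact Measurable.ite measurableSet_Iio measurable_const measurable_const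
  have hgr : ∀ x, ENNReal.ofReal (Real.exp (-1)) ≤ Q {w | sgn ⟪w, x⟫ = sgn ⟪μ, x⟫} := by
    intro x
    by_cases h : ⟪μ, x⟫ < 0
    · refine (grun_gen Q q hq0 hQq S hSconv hsupp hlogconc hint (-x)).trans
        (measure_mono fun w hw => ?_)
      rw [← hμ] at hw
      simp only [Set.mem_ofPred_eq, inner_neg_right] at hw ⊢
      rw [hsgn, hsgn, if_pos h, if_pos (by linarith)]
    · refine (grun_gen Q q hq0 hQq S hSconv hsupp hlogconc hint x).trans
        (measure_mono fun w hw => ?_)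
      rw [← hμ] at hw
      simp only [Set.mem_ofPred_eq] at hw ⊢
      rw [hsgn, hsgn, if_neg h, if_neg (by linarith)]
  have hA : MeasurableSet {p : 𝒳 × ℝ | sgn ⟪μ, φ p.1⟫ ≠ p.2} := by
    refine (measurableSet_eq_fun (hsm.comp ?_) measurable_snd).compl
    fun_prop
  have hB : MeasurableSet {z : EuclideanSpace ℝ (Fin d) × (𝒳 × ℝ) |
      sgn ⟪z.1, φ z.2.1⟫ ≠ z.2.2} := by
    refine (measurableSet_eq_fun (hsm.comp ?_) (by fun_prop)).compl
    fun_prop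
  rw [Measure.prod_apply_symm hB]
  have hlow : ENNReal.ofReal (Real.exp (-1)) * D {p : 𝒳 × ℝ | sgn ⟪μ, φ p.1⟫ ≠ p.2} ≤
      ∫⁻ p, Q ((fun w => (w, p)) ⁻¹' {z : EuclideanSpace ℝ (Fin d) × (𝒳 × ℝ) |
        sgn ⟪z.1, φ z.2.1⟫ ≠ z.2.2}) ∂D := by
    rw [← lintegral_indicator_const hA]
    refine lintegral_mono fun p => ?_
    by_cases hp : p ∈ {p : 𝒳 × ℝ | sgn ⟪μ, φ p.1⟫ ≠ p.2}
    · rw [Set.indicator_of_mem hp]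
      refine (hgr (φ p.1)).trans (measure_mono fun w hw => ?_)
      simp only [Set.mem_ofPred_eq, Set.mem_preimage] at hw hp ⊢
      rw [hw]; exact hp
    · rw [Set.indicator_of_notMem hp]; exact zero_le
  calc D {p : 𝒳 × ℝ | sgn ⟪μ, φ p.1⟫ ≠ p.2}
      = ENNReal.ofReal (Real.exp 1) * (ENNReal.ofReal (Real.exp (-1)) *
          D {p : 𝒳 × ℝ | sgn ⟪μ, φ p.1⟫ ≠ p.2}) := by
        rw [← mul_assoc, ← ENNReal.ofReal_mul (Real.exp_pos _).le, ← Real.exp_add]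
        simp
    _ ≤ _ := by gcongr
end
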